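/- Let A = (V, E_R, E_W) be an annotation DAG and let r ∈ R be such that at least one edge of E_W carries label r. Then the r-labeled E_W edges form a single directed simple path starting at ⊥: there is a unique finite sequence of distinct nodes ⊥ = v₀, v₁, …, v_n with n ≥ 1 such that the set of edges of E_W with label r is exactly {(v_i, r, v_{i+1}) | 0 ≤ i < n}; in particular, v_n is the unique node that is reachable from ⊥ via r-labeled E_W edges and has no outgoing r-labeled E_W edge. -/

import Mathlib

namespace CRIL

/-- Process identifiers: finite lists of positive integers. -/
abbrev PID := List ℕ+

/-- Nodes of an annotation DAG: either ⊥ or a pair (p, n). -/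
inductive ANode where
  | bot : ANode
  | node : PID → ℕ → ANode
deriving DecidableEq

/-- Labeled edges. -/
abbrev AEdge (R : Type) := ANode × R × ANode

/-- Annotation DAGs, with the five defining conditions. -/
structure AnnDAG (R : Type) where
  V : Set ANode
  ER : Set (AEdge R)
  EW : Set (AEdge R)
  finV : V.Finite
  bot_mem : ANode.bot ∈ V
  down : ∀ p n, ANode.node p n ∈ V → ∀ n' ≤ n, ANode.node p n' ∈ V
  edges_sub : ∀ e ∈ ER ∪ EW, e.1 ∈ V ∧ e.2.2 ∈ V
  in_unique : ∀ v' v'' r v, (v', r, v) ∈ ER ∪ EW → (v'', r, v) ∈ ER ∪ EW → v' = v''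
  disj : ER ∩ EW = ∅
  acyclic : ∀ v, ¬ Relation.TransGen (fun a b => ∃ r, (a, r, b) ∈ ER ∪ EW) v v
  w_pred : ∀ v' r v, (v', r, v) ∈ EW → v' ≠ ANode.bot → ∃ v'', (v'', r, v') ∈ EW
  w_out_unique : ∀ v r v' v'', (v, r, v') ∈ EW → (v, r, v'') ∈ EW → v' = v''

-- `last(r, E_W)`: the final node of the unique maximal chain of `r`-labeled
-- `E_W`-edges starting at ⊥ (⊥ if there is no such edge).
open Classical in
noncomputable def lastN {R : Type} (EW : Set (AEdge R)) (r : R) : ANode :=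
  if h : ∃! v, Relation.ReflTransGen (fun a b => (a, r, b) ∈ EW) ANode.bot v ∧
      ∀ w, (v, r, w) ∉ EW
  then h.exists.choose
  else ANode.bot

/-- `max_p(V) + 1`: one plus the largest `n` with `(p,n) ∈ V` (0 if none). -/
noncomputable def maxpSucc (V : Set ANode) (p : PID) : ℕ :=
  sSup {m : ℕ | ∃ n, m = n + 1 ∧ ANode.node p n ∈ V}

/-- `max_p(V)` as an integer, −1 if no `(p,n) ∈ V`. -/
noncomputable def maxp (V : Set ANode) (p : PID) : ℤ :=
  (maxpSucc V p : ℤ) - 1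

/-- Labels (p, Rd, Wt). -/
abbrev Label (R : Type) := PID × Set R × Set R

/-- Forward annotation transition A₁ ⇀(p,Rd,Wt) A₂. -/
def Step {R : Type} (A₁ A₂ : AnnDAG R) (p : PID) (Rd Wt : Set R) : Prop :=
  A₂.V = A₁.V ∪ {ANode.node p (maxpSucc A₁.V p)} ∧
  A₂.ER = A₁.ER ∪
    {e | ∃ r ∈ Rd \ Wt, e = (lastN A₁.EW r, r, ANode.node p (maxpSucc A₁.V p))} ∧
  A₂.EW = A₁.EW ∪
    {e | ∃ r ∈ Wt, e = (lastN A₁.EW r, r, ANode.node p (maxpSucc A₁.V p))}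

/-- Forward transition with some label. -/
def StepAny {R : Type} (A₁ A₂ : AnnDAG R) : Prop := ∃ p Rd Wt, Step A₁ A₂ p Rd Wt

/-- Forward transition with some label in `O`. -/
def StepIn {R : Type} (O : Set (Label R)) (A₁ A₂ : AnnDAG R) : Prop :=
  ∃ l ∈ O, Step A₁ A₂ l.1 l.2.1 l.2.2

/-- The initial annotation DAG ({⊥}, ∅, ∅). -/
def Ainit (R : Type) : AnnDAG R where
  V := {ANode.bot}
  ER := ∅
  EW := ∅
  finV := Set.finite_singleton _
  bot_mem := rfl
  down := by intro p n h; simp at h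
  edges_sub := by intro e he; simp at he
  in_unique := by intro v' v'' r v h; simp at h
  disj := by simp
  acyclic := by
    intro v h
    have hne : ∀ a b : ANode, ¬ ∃ r : R, (a, r, b) ∈ (∅ ∪ ∅ : Set (AEdge R)) := by simp
    cases h with
    | single h' => exact hne _ _ h'
    | tail _ h' => exact hne _ _ h'
  w_pred := by intro v' r v h; simp at h
  w_out_unique := by intro v r v' v'' h; simp at h

/-- Signed labels: forward or underlined (backward). -/
inductive SLabel (R : Type) where
  | fwd : Label R → SLabel R
  | bwd : Label R → SLabel R

/-- `und`: forget the underline. -/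
def und {R : Type} : SLabel R → Label R
  | .fwd a => a
  | .bwd a => a

/-- The underline-toggle. -/
def toggle {R : Type} : SLabel R → SLabel R
  | .fwd a => .bwd a
  | .bwd a => .fwd a

/-- Combined transitions: forward, or reversed forward. -/
def CStep {R : Type} (A A' : AnnDAG R) : SLabel R → Prop
  | .fwd a => Step A A' a.1 a.2.1 a.2.2
  | .bwd a => Step A' A a.1 a.2.1 a.2.2

/-- Independence of signed labels: incomparable pids and disjoint read/write sets. -/
def indepLab {R : Type} (α β : SLabel R) : Prop :=
  ¬ (und α).1 <+: (und β).1 ∧ ¬ (und β).1 <+: (und α).1 ∧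
  (und α).2.1 ∩ (und β).2.2 = ∅ ∧ (und β).2.1 ∩ (und α).2.2 = ∅

/-- `diff` of a combined transition. -/
def diff {R : Type} (A A' : AnnDAG R) (α : SLabel R) :
    Set ANode × Set (AEdge R) × Set (AEdge R) :=
  match α with
  | .fwd _ => (A'.V \ A.V, A'.ER \ A.ER, A'.EW \ A.EW)
  | .bwd _ => (A.V \ A'.V, A.ER \ A'.ER, A.EW \ A'.EW)

/-- The underlying triple of an annotation DAG. -/
def triple {R : Type} (A : AnnDAG R) : Set ANode × Set (AEdge R) × Set (AEdge R) :=
  (A.V, A.ER, A.EW)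

/-- The ⊙^α operation on triples. -/
def odot {R : Type} (α : SLabel R)
    (T Δ : Set ANode × Set (AEdge R) × Set (AEdge R)) :
    Set ANode × Set (AEdge R) × Set (AEdge R) :=
  match α with
  | .fwd _ => (T.1 ∪ Δ.1, T.2.1 ∪ Δ.2.1, T.2.2 ∪ Δ.2.2)
  | .bwd _ => (T.1 \ Δ.1, T.2.1 \ Δ.2.1, T.2.2 \ Δ.2.2)


/-- Two maximal chains of a right-unique relation with the same first element coincide. -/
theorem isChain_cons_unique_of_maximal {α : Type*} {E : α → α → Prop}
    (huniq : ∀ a b c, E a b → E a c → b = c) (l l' : List α) (v : α)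
    (hl : List.IsChain E (v :: l)) (hl' : List.IsChain E (v :: l'))
    (hmax : ∀ w, ¬ E ((v :: l).getLast (by simp)) w)
    (hmax' : ∀ w, ¬ E ((v :: l').getLast (by simp)) w) : l' = l := by
  induction l generalizing l' v with
  | nil =>
    cases l' with
    | nil => rfl
    | cons b t =>
      rw [List.isChain_cons_cons] at hl'
      exact absurd hl'.1 (hmax b)
  | cons a t ih =>
    rw [List.isChain_cons_cons] at hl
    cases l' with
    | nil => exact absurd hl.1 (hmax' a)
    | cons b t' =>
      rw [List.isChain_cons_cons] at hl'
      obtain rfl := huniq _ _ _ hl.1 hl'.1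
      rw [ih t' a hl.2 hl'.2 (by simpa using hmax) (by simpa using hmax')]

/-- If the converse of `E` is well-founded, every element starts a maximal `E`-chain. -/
theorem exists_maximal_isChain {α : Type*} {E : α → α → Prop}
    (hwf : WellFounded (flip E)) (v : α) :
    ∃ l : List α, List.IsChain E (v :: l) ∧ ∀ w, ¬ E ((v :: l).getLast (by simp)) w := by
  induction v using hwf.induction with
  | _ v ih =>
    by_cases h : ∃ w, E v w
    · obtain ⟨w, hw⟩ := h
      obtain ⟨l, hl, hmax⟩ := ih w hw
      exact ⟨w :: l, List.isChain_cons_cons.2 ⟨hw, hl⟩, by simpa using hmax⟩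
    · exact ⟨[], List.isChain_singleton v, by simpa using h⟩

/-- An acyclic relation supported on a finite set is well-founded. -/
theorem wellFounded_of_acyclic_of_finite {α : Type*} {E : α → α → Prop} {s : Set α}
    (hs : s.Finite) (hsub : ∀ a b, E a b → a ∈ s ∧ b ∈ s)
    (hacyc : ∀ v, ¬ Relation.TransGen E v v) : WellFounded E := by
  have : IsStrictOrder α (Relation.TransGen E) :=
    { irrefl := hacyc, trans := fun _ _ _ => Relation.TransGen.trans }
  have hwf : s.WellFoundedOn (Relation.TransGen E) := hs.wellFoundedOn
  have hmem : ∀ a ∈ s, Acc E a := by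
    intro a ha
    refine hwf.induction ha fun b _ ih => ⟨b, fun c hc => ?_⟩
    exact ih c (hsub c b hc).1 (.single hc)
  exact ⟨fun a => ⟨a, fun b hb => hmem b (hsub b a hb).1⟩⟩

/-- The elements reachable from the start of a maximal chain lie on that chain. -/
theorem mem_of_reflTransGen_of_maximal {α : Type*} {E : α → α → Prop}
    (huniq : ∀ a b c, E a b → E a c → b = c) (l : List α) (v x : α)
    (hl : List.IsChain E (v :: l)) (hmax : ∀ w, ¬ E ((v :: l).getLast (by simp)) w)
    (hx : Relation.ReflTransGen E v x) : x ∈ v :: l := by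
  induction l generalizing v with
  | nil =>
    rcases hx.cases_head with rfl | ⟨b, hb, _⟩
    · simp
    · exact absurd hb (hmax b)
  | cons a t ih =>
    rw [List.isChain_cons_cons] at hl
    rcases hx.cases_head with rfl | ⟨b, hb, hbx⟩
    · simp
    · obtain rfl := huniq _ _ _ hl.1 hb
      exact List.mem_cons_of_mem _ (ih a hl.2 (by simpa using hmax) hbx)

/-- The edges out of a vertex of a maximal chain are edges of that chain. -/
theorem exists_getElem_of_maximal {α : Type*} {E : α → α → Prop}
    (huniq : ∀ a b c, E a b → E a c → b = c) (l : List α) (hne : l ≠ [])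
    (hl : List.IsChain E l) (hmax : ∀ w, ¬ E (l.getLast hne) w) {a b : α}
    (ha : a ∈ l) (hab : E a b) :
    ∃ i : ℕ, ∃ hi : i + 1 < l.length, a = l[i]'(Nat.lt_of_succ_lt hi) ∧ b = l[i + 1]'hi := by
  obtain ⟨i, hi, rfl⟩ := List.getElem_of_mem ha
  by_cases hlt : i + 1 < l.length
  · exact ⟨i, hlt, rfl, huniq _ _ _ hab (List.isChain_iff_getElem.1 hl i hlt)⟩
  · have hlast : l.getLast hne = l[i] := by
      rw [List.getLast_eq_getElem]
      congr 1
      omega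
    exact absurd hab (hlast ▸ hmax b)

/-- The chain condition and maximality of a duplicate-free list whose consecutive pairs are
exactly the `E`-edges. -/
theorem isChain_and_maximal_of_edges_iff {α : Type*} {E : α → α → Prop} (l : List α)
    (hne : l ≠ []) (hnd : l.Nodup)
    (hedge : ∀ a b : α, E a b ↔ ∃ i : ℕ, ∃ hi : i + 1 < l.length,
      a = l[i]'(Nat.lt_of_succ_lt hi) ∧ b = l[i + 1]'hi) :
    List.IsChain E l ∧ ∀ w, ¬ E (l.getLast hne) w := by
  refine ⟨List.isChain_iff_getElem.2 fun i hi => (hedge _ _).2 ⟨i, hi, rfl, rfl⟩, fun w hw => ?_⟩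
  obtain ⟨i, hi, ha, -⟩ := (hedge _ _).1 hw
  rw [List.getLast_eq_getElem, hnd.getElem_inj_iff] at ha
  omega

/-- in an annotation DAG the `r`-labeled `E_W` edges form a unique
directed simple path starting at ⊥; in particular its endpoint is the unique node
reachable from ⊥ via `r`-labeled `E_W` edges with no outgoing `r`-labeled `E_W` edge. -/
theorem stmt2 {R : Type} (A : AnnDAG R) (r : R)
    (h : ∃ v v' : ANode, (v, r, v') ∈ A.EW) :
    ∃ vs : List ANode,
      ((2 ≤ vs.length ∧ vs.Nodup ∧ vs.head? = some ANode.bot ∧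
          (∀ a b : ANode, (a, r, b) ∈ A.EW ↔
            ∃ i : ℕ, ∃ hi : i + 1 < vs.length,
              a = vs[i]'(Nat.lt_of_succ_lt hi) ∧ b = vs[i+1]'hi)) ∧
        ∀ vs' : List ANode,
          (2 ≤ vs'.length ∧ vs'.Nodup ∧ vs'.head? = some ANode.bot ∧
            (∀ a b : ANode, (a, r, b) ∈ A.EW ↔
              ∃ i : ℕ, ∃ hi : i + 1 < vs'.length,
                a = vs'[i]'(Nat.lt_of_succ_lt hi) ∧ b = vs'[i+1]'hi)) → vs' = vs) ∧
      ∃ v : ANode, vs.getLast? = some v ∧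
        (Relation.ReflTransGen (fun a b => (a, r, b) ∈ A.EW) ANode.bot v ∧
          ∀ w, (v, r, w) ∉ A.EW) ∧
        ∀ v' : ANode,
          (Relation.ReflTransGen (fun a b => (a, r, b) ∈ A.EW) ANode.bot v' ∧
            ∀ w, (v', r, w) ∉ A.EW) → v' = v := by
  set E : ANode → ANode → Prop := fun a b => (a, r, b) ∈ A.EW
  have huniq : ∀ a b c, E a b → E a c → b = c := fun a b c => A.w_out_unique a r b c
  have hsub : ∀ a b, E a b → a ∈ A.V ∧ b ∈ A.V := fun a b hab => A.edges_sub _ (Or.inr hab)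
  have hacyc : ∀ v, ¬ Relation.TransGen E v v := fun v hv =>
    A.acyclic v (hv.lift id fun _ _ hab => ⟨r, Or.inr hab⟩)
  have hwf : WellFounded E := wellFounded_of_acyclic_of_finite A.finV hsub hacyc
  have hwf' : WellFounded (flip E) :=
    wellFounded_of_acyclic_of_finite A.finV (fun a b hab => (hsub b a hab).symm)
      fun v hv => hacyc v (Relation.transGen_swap.1 hv)
  have hreach : ∀ a b, E a b → Relation.ReflTransGen E ANode.bot a := by
    intro a
    induction a using hwf.induction with
    | _ a ih =>
      intro b hab
      by_cases ha : a = ANode.bot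
      · rw [ha]
      · obtain ⟨c, hc⟩ := A.w_pred a r b hab ha
        exact (ih c hc a hc).tail hc
  obtain ⟨l, hl, hmax⟩ := exists_maximal_isChain hwf' ANode.bot
  have hnd : (ANode.bot :: l).Nodup := by
    have hpw : (ANode.bot :: l).Pairwise (Relation.TransGen E) :=
      List.isChain_iff_pairwise.1 (hl.imp fun _ _ => Relation.TransGen.single)
    refine List.Pairwise.imp (S := fun a b => a ≠ b) ?_ hpw
    rintro a _ hab rfl
    exact hacyc a hab
  have hmem : ∀ x, Relation.ReflTransGen E ANode.bot x → x ∈ ANode.bot :: l := fun x =>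
    mem_of_reflTransGen_of_maximal huniq l ANode.bot x hl hmax
  have hedge : ∀ a b : ANode, E a b ↔ ∃ i : ℕ, ∃ hi : i + 1 < (ANode.bot :: l).length,
      a = (ANode.bot :: l)[i]'(Nat.lt_of_succ_lt hi) ∧ b = (ANode.bot :: l)[i + 1]'hi := by
    refine fun a b => ⟨fun hab => ?_, ?_⟩
    · exact exists_getElem_of_maximal huniq _ (by simp) hl hmax (hmem a (hreach a b hab)) hab
    · rintro ⟨i, hi, rfl, rfl⟩
      exact List.isChain_iff_getElem.1 hl i hi
  refine ⟨ANode.bot :: l, ⟨⟨?_, hnd, rfl, hedge⟩, ?_⟩,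
    (ANode.bot :: l).getLast (by simp), List.getLast?_eq_some_getLast _, ⟨?_, hmax⟩, ?_⟩
  · obtain ⟨a, b, hab⟩ := h
    obtain ⟨i, hi, -⟩ := (hedge a b).1 hab
    omega
  · rintro vs' ⟨-, hnd', hhead, hedge'⟩
    obtain ⟨l', rfl⟩ := List.head?_eq_some_iff.1 hhead
    obtain ⟨hl', hmax'⟩ := isChain_and_maximal_of_edges_iff (E := E) _ (by simp) hnd' hedge'
    rw [isChain_cons_unique_of_maximal huniq l l' _ hl hl' hmax hmax']
  · exact List.relationReflTransGen_of_exists_isChain_cons l hl rfl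
  · rintro v' ⟨hv', hout⟩
    obtain ⟨i, hi, rfl⟩ := List.getElem_of_mem (hmem v' hv')
    by_cases hlt : i + 1 < (ANode.bot :: l).length
    · exact absurd (List.isChain_iff_getElem.1 hl i hlt) (hout _)
    · rw [List.getLast_eq_getElem]
      congr 1
      omega

end CRIL
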